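/- arXiv:1404.2443 — 2 statements merged into one kernel-verified Lean document; each statement's English description precedes it below -/
import Mathlib

section
/- A hexagon has intersection complexity 5 if and only if, for some cyclic labeling of its vertices, the lines through p_0 and p_5, through p_1 and p_4, and through p_2 and p_3 meet in a common point of the projective plane. Precisely: if p_0, …, p_5 ∈ ℝ² are in clockwise convex position and P = conv{p_0, …, p_5}, then P is a section of a polytope with at most 5 vertices in some ℝ^D if and only if det(p̂_0 × p̂_5, p̂_1 × p̂_4, p̂_2 × p̂_3) = 0 or det(p̂_1 × p̂_0, p̂_2 × p̂_5, p̂_3 × p̂_4) = 0 or det(p̂_2 × p̂_1, p̂_3 × p̂_0, p̂_4 × p̂_5) = 0, where × is the cross product on ℝ³. -/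
open Matrix

/-- Homogeneous coordinates of a point in the plane. -/
noncomputable def hat (p : Fin 2 → ℝ) : Fin 3 → ℝ := ![p 0, p 1, 1]

/-- Determinant of the 3×3 matrix with rows `u`, `v`, `w`. -/
def det3 (u v w : Fin 3 → ℝ) : ℝ := Matrix.det (Matrix.of ![u, v, w])

/-- The cross product on ℝ³. -/
def cross3 (u v : Fin 3 → ℝ) : Fin 3 → ℝ := crossProduct u v

/-- The pairs `(a, b)` of bitmasks of sets of vertices of a hexagon, where `b` encodes a single
vertex and `a` that vertex together with the two ends of an edge that does not contain it. -/
def nonIncidenceMasks : List (ℕ × ℕ) :=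
  [(7, 4), (11, 8), (19, 16), (35, 32), (7, 1), (14, 8), (22, 16), (38, 32),
   (13, 1), (14, 2), (28, 16), (44, 32), (25, 1), (26, 2), (28, 4), (56, 32),
   (49, 1), (50, 2), (52, 4), (56, 8), (35, 2), (37, 4), (41, 8), (49, 16)]

/-- Whether the vertex set encoded by `m` contains the vertex and avoids the edge given by `e`. -/
def separates (m : ℕ) (e : ℕ × ℕ) : Bool := Nat.beq (Nat.land m e.1) e.2

/-- The vertex sets that separate the vertex and the edge given by `e`. -/
def separators (e : ℕ × ℕ) : List ℕ := (List.range 64).filter fun m => separates m e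

/-- Bitmasks of the sets of edges of a triangular bipyramid that meet at a common vertex, when a
plane section cuts six edges of the bipyramid and these are numbered around the section. The
parameter rotates the numbering. -/
def bipyramidMasks : Fin 3 → Fin 5 → ℕ :=
  ![![7, 56, 33, 18, 12], ![14, 49, 3, 36, 24], ![28, 35, 6, 9, 48]]

/-- Exhaustive search for the ways to extend the list `L` by `n` vertex sets that separate all the
pairs in `U`; the result tells whether all of them contain some `bipyramidMasks r`. -/
def searchSeparators : ℕ → List (ℕ × ℕ) → List ℕ → Bool
  | 0, [], L => decide (∃ r, ∀ v, bipyramidMasks r v ∈ L)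
  | 0, _ :: _, _ => true
  | _ + 1, [], _ => false
  | n + 1, e :: U, L => (separators e).all fun m =>
      searchSeparators n (U.filter fun e' => !separates m e') (m :: L)

theorem searchSeparators_nonIncidenceMasks :
    searchSeparators 5 nonIncidenceMasks [] = true := by
  decide +kernel

theorem exists_bipyramidMasks_mem_of_searchSeparators (n : ℕ) (U : List (ℕ × ℕ)) (L M : List ℕ)
    (hn : M.length = n) (hM : ∀ m ∈ M, m < 64) (h : searchSeparators n U L = true)
    (hU : ∀ e ∈ U, ∃ m ∈ M, separates m e) :
    ∃ r, ∀ v, bipyramidMasks r v ∈ M ++ L := by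
  induction n generalizing U L M with
  | zero =>
    obtain rfl := List.length_eq_zero_iff.mp hn
    match U with
    | [] => simpa [searchSeparators] using h
    | e :: U => simpa using hU e
  | succ n ih =>
    match U with
    | [] => simp [searchSeparators] at h
    | e :: U =>
      obtain ⟨m, hm, hme⟩ := hU e (by simp)
      have hp : (M.erase m ++ m :: L).Perm (M ++ L) :=
        List.perm_middle.trans ((List.perm_cons_erase hm).symm.append_right L)
      obtain ⟨r, hr⟩ := ih (U.filter fun e' => !separates m e') (m :: L) (M.erase m)
        (by rw [List.length_erase_of_mem hm, hn]; rfl)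
        (fun x hx => hM x (List.mem_of_mem_erase hx))
        (by
          rw [searchSeparators, List.all_eq_true] at h
          exact h m (List.mem_filter.mpr ⟨List.mem_range.mpr (hM m hm), hme⟩))
        (fun e' he' => by
          obtain ⟨he', hne⟩ := List.mem_filter.mp he'
          obtain ⟨x, hx, hxe⟩ := hU e' (by simp [he'])
          refine ⟨x, (List.mem_erase_of_ne ?_).mpr hx, hxe⟩
          rintro rfl
          simp [hxe] at hne)
      exact ⟨r, fun v => hp.mem_iff.mp (hr v)⟩

theorem exists_nonIncidence_of_mem_nonIncidenceMasks : ∀ e ∈ nonIncidenceMasks,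
    ∃ j k : Fin 6, k ≠ j ∧ k ≠ j + 1 ∧ ∀ m < 64, m.testBit k = true → m.testBit j = false →
      m.testBit (j + 1 : Fin 6) = false → separates m e = true := by
  decide +kernel

theorem exists_testBit_eq : ∀ b : Fin 6 → Bool, ∃ m < 64, ∀ i : Fin 6, m.testBit i = b i := by
  decide +kernel

/-- The vertices of a hexagon that lie on the edges of a triangular bipyramid meeting at a common
vertex, when the hexagon is a plane section of the bipyramid. -/
def bipyramidStar : Fin 5 → Finset (Fin 6) := ![{0, 1, 2}, {3, 4, 5}, {0, 5}, {1, 4}, {2, 3}]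

theorem testBit_bipyramidMasks : ∀ (r : Fin 3) (v : Fin 5) (i : Fin 6),
    (bipyramidMasks r v).testBit (i + r.castLE (by norm_num) : Fin 6) =
      decide (i ∈ bipyramidStar v) := by
  decide +kernel

theorem bipyramidMasks_injective : ∀ r, Function.Injective (bipyramidMasks r) := by
  unfold Function.Injective
  decide +kernel

/-- If five vertex sets of a hexagon separate each edge from each vertex not on it, then they are
the stars of a triangular bipyramid up to relabeling and rotation. -/
theorem exists_bipyramidStar_of_separates (s : Fin 6 → Fin 5 → Prop)
    (hs : ∀ j k, k ≠ j → k ≠ j + 1 → ∃ v, s k v ∧ ¬ s j v ∧ ¬ s (j + 1) v) :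
    ∃ (r : Fin 3) (σ : Equiv.Perm (Fin 5)), ∀ v i,
      s (i + r.castLE (by norm_num)) (σ v) ↔ i ∈ bipyramidStar v := by
  classical
  choose m hm hms using fun v => exists_testBit_eq fun i => decide (s i v)
  obtain ⟨r, hr⟩ := exists_bipyramidMasks_mem_of_searchSeparators 5 nonIncidenceMasks []
    (List.ofFn m) (by simp) (fun x hx => by obtain ⟨v, rfl⟩ := List.mem_ofFn.mp hx; exact hm v)
    searchSeparators_nonIncidenceMasks (fun e he => by
      obtain ⟨j, k, hkj, hkj', hsep⟩ := exists_nonIncidence_of_mem_nonIncidenceMasks e he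
      obtain ⟨v, hk, hj, hj'⟩ := hs j k hkj hkj'
      exact ⟨m v, List.mem_ofFn.mpr ⟨v, rfl⟩,
        hsep _ (hm v) (by simp [hms, hk]) (by simp [hms, hj]) (by simp [hms, hj'])⟩)
  simp only [List.append_nil, List.mem_ofFn] at hr
  choose σ hσ using hr
  have hinj : Function.Injective σ := fun a b hab =>
    bipyramidMasks_injective r (by rw [← hσ a, ← hσ b, hab])
  refine ⟨r, Equiv.ofBijective σ (Finite.injective_iff_bijective.mp hinj), fun v i => ?_⟩
  have h := testBit_bipyramidMasks r v i
  rw [← hσ, hms] at h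
  simpa using h

theorem mem_convexHull_range_iff {ι E : Type*} [Fintype ι] [AddCommGroup E] [Module ℝ E]
    (w : ι → E) (x : E) : x ∈ convexHull ℝ (Set.range w) ↔
      ∃ μ : ι → ℝ, (∀ i, 0 ≤ μ i) ∧ ∑ i, μ i = 1 ∧ ∑ i, μ i • w i = x := by
  classical
  refine ⟨fun hx => ?_, fun ⟨μ, h0, h1, h⟩ =>
    mem_convexHull_of_exists_fintype μ w h0 h1 (fun i => ⟨i, rfl⟩) h⟩
  have hw : Set.range w = Fintype.linearCombination ℝ w '' Set.range fun i j : ι =>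
      if i = j then (1 : ℝ) else 0 := by
    rw [← Set.range_comp]
    congr 1
    ext i
    simp [Fintype.linearCombination_apply]
  rw [hw, ← LinearMap.image_convexHull, convexHull_basis_eq_stdSimplex] at hx
  obtain ⟨μ, hμ, rfl⟩ := hx
  exact ⟨μ, hμ.1, hμ.2, rfl⟩

/-- Every finite set with between one and `n` elements is the range of an `n`-tuple. -/
theorem exists_range_eq_coe {α : Type*} {n : ℕ} (V : Finset α) (hV : V.Nonempty)
    (hn : V.card ≤ n) : ∃ w : Fin n → α, Set.range w = V := by
  obtain ⟨e⟩ := Function.Embedding.nonempty_of_card_le (α := V) (β := Fin n) (by simpa using hn)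
  have : Nonempty V := hV.to_subtype
  refine ⟨Subtype.val ∘ Function.invFun e, ?_⟩
  rw [Set.range_comp, (Function.invFun_surjective e.injective).range_eq]
  simp

theorem det3_hat (a b c : Fin 2 → ℝ) : det3 (hat a) (hat b) (hat c) =
    a 0 * (b 1 - c 1) - a 1 * (b 0 - c 0) + (b 0 * c 1 - b 1 * c 0) := by
  simp [det3, hat, Matrix.det_fin_three]
  ring

theorem det3_rotate (u v w : Fin 3 → ℝ) : det3 u v w = det3 v w u := by
  simp only [det3, Matrix.det_fin_three, Matrix.of_apply, Matrix.cons_val]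
  ring

/-- Points in clockwise convex position. -/
def Clockwise {n : ℕ} (p : Fin n → Fin 2 → ℝ) : Prop :=
  ∀ i j k, i < j → j < k → det3 (hat (p i)) (hat (p j)) (hat (p k)) < 0

theorem Clockwise.det3_edge_neg {p : Fin 6 → Fin 2 → ℝ} (hp : Clockwise p) (j k : Fin 6)
    (hkj : k ≠ j) (hkj' : k ≠ j + 1) :
    det3 (hat (p j)) (hat (p (j + 1))) (hat (p k)) < 0 := by
  rcases eq_or_ne j 5 with rfl | hj
  · rw [det3_rotate]
    exact hp _ _ _ (by omega) (by omega)
  · rcases lt_or_gt_of_ne hkj with h | h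
    · rw [← det3_rotate]
      exact hp _ _ _ h (by omega)
    · exact hp _ _ _ (by omega) (by omega)

theorem Clockwise.rotate {p : Fin 6 → Fin 2 → ℝ} (hp : Clockwise p) :
    Clockwise fun i => p (i + 1) := by
  intro i j k hij hjk
  rcases eq_or_ne k 5 with rfl | hk
  · rw [← det3_rotate]
    exact hp _ _ _ (by omega) (by omega)
  · exact hp _ _ _ (by omega) (by omega)

theorem det3_hat_combo (u v x y : Fin 2 → ℝ) (a b : ℝ) (hab : a + b = 1) :
    det3 (hat u) (hat v) (hat (a • x + b • y)) =
      a * det3 (hat u) (hat v) (hat x) + b * det3 (hat u) (hat v) (hat y) := by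
  obtain rfl : b = 1 - a := by linarith
  simp only [det3_hat, Pi.add_apply, Pi.smul_apply, smul_eq_mul]
  ring

theorem det3_hat_self_left (u v : Fin 2 → ℝ) : det3 (hat u) (hat v) (hat u) = 0 := by
  rw [det3_hat]; ring

theorem det3_hat_self_right (u v : Fin 2 → ℝ) : det3 (hat u) (hat v) (hat v) = 0 := by
  rw [det3_hat]; ring

theorem Clockwise.det3_edge_nonpos {p : Fin 6 → Fin 2 → ℝ} (hp : Clockwise p) (j : Fin 6)
    {x : Fin 2 → ℝ} (hx : x ∈ convexHull ℝ (Set.range p)) :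
    det3 (hat (p j)) (hat (p (j + 1))) (hat x) ≤ 0 := by
  refine convexHull_min (t := {x | det3 (hat (p j)) (hat (p (j + 1))) (hat x) ≤ 0}) ?_ ?_ hx
  · rintro _ ⟨k, rfl⟩
    rcases eq_or_ne k j with rfl | hkj
    · exact (det3_hat_self_left _ _).le
    rcases eq_or_ne k (j + 1) with rfl | hkj'
    · exact (det3_hat_self_right _ _).le
    exact (hp.det3_edge_neg j k hkj hkj').le
  · intro x hx y hy a b ha hb hab
    simp only [Set.mem_ofPred_eq] at *
    rw [det3_hat_combo _ _ _ _ _ _ hab]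
    nlinarith

/-- A presentation of the hexagon with vertices `p` as the section of the convex hull of the points
`w` by the image of `f`, where `l i` are barycentric coordinates of the vertex `p i`. -/
structure IsSection {D : ℕ} (p : Fin 6 → Fin 2 → ℝ) (w : Fin 5 → Fin D → ℝ)
    (f : (Fin 2 → ℝ) →ᵃ[ℝ] (Fin D → ℝ)) (l : Fin 6 → Fin 5 → ℝ) : Prop where
  clockwise : Clockwise p
  injective : Function.Injective f
  inter_eq : convexHull ℝ (Set.range w) ∩ Set.range f = f '' convexHull ℝ (Set.range p)
  nonneg : ∀ i v, 0 ≤ l i v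
  sum_eq_one : ∀ i, ∑ v, l i v = 1
  combo_eq : ∀ i, ∑ v, l i v • w v = f (p i)

namespace IsSection

variable {D : ℕ} {p : Fin 6 → Fin 2 → ℝ} {w : Fin 5 → Fin D → ℝ}
  {f : (Fin 2 → ℝ) →ᵃ[ℝ] (Fin D → ℝ)} {l : Fin 6 → Fin 5 → ℝ}

theorem mem_convexHull (h : IsSection p w f l) {x : Fin 2 → ℝ} {μ : Fin 5 → ℝ}
    (h0 : ∀ v, 0 ≤ μ v) (h1 : ∑ v, μ v = 1) (hx : ∑ v, μ v • w v = f x) :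
    x ∈ convexHull ℝ (Set.range p) := by
  have hfx : f x ∈ f '' convexHull ℝ (Set.range p) :=
    h.inter_eq ▸ ⟨(mem_convexHull_range_iff _ _).mpr ⟨μ, h0, h1, hx⟩, x, rfl⟩
  exact (h.injective.mem_set_image).mp hfx

/-- A point of the section that is a combination of the vertices of the polytope used for the two
ends of an edge lies on the line through this edge. -/
theorem det3_edge_eq_zero (h : IsSection p w f l) (j : Fin 6) {x : Fin 2 → ℝ} {μ : Fin 5 → ℝ}
    (h0 : ∀ v, 0 ≤ μ v) (h1 : ∑ v, μ v = 1) (hx : ∑ v, μ v • w v = f x)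
    (hμ : ∀ v, μ v ≠ 0 → l j v ≠ 0 ∨ l (j + 1) v ≠ 0) :
    det3 (hat (p j)) (hat (p (j + 1))) (hat x) = 0 := by
  refine le_antisymm (h.clockwise.det3_edge_nonpos j (h.mem_convexHull h0 h1 hx)) ?_
  have hε : ∀ᶠ ε in nhdsWithin (0 : ℝ) (Set.Ioi 0), ∀ v, ε * μ v ≤ (l j v + l (j + 1) v) / 2 := by
    refine Filter.eventually_all.mpr fun v => ?_
    have hj := h.nonneg j v
    have hj' := h.nonneg (j + 1) v
    rcases eq_or_ne (μ v) 0 with hv | hv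
    · exact Filter.Eventually.of_forall fun ε => by rw [hv]; linarith
    · have hpos : 0 < (l j v + l (j + 1) v) / 2 := by
        rcases hμ v hv with hl | hl <;> have := lt_of_le_of_ne' (h.nonneg _ v) hl <;> linarith
      have hμv := lt_of_le_of_ne' (h0 v) hv
      filter_upwards [Ioo_mem_nhdsGT (div_pos hpos hμv)] with ε hε
      exact ((lt_div_iff₀ hμv).mp hε.2).le
  obtain ⟨ε, hε, hε0⟩ := (hε.and self_mem_nhdsWithin).exists
  set m : Fin 2 → ℝ := (1 / 2 : ℝ) • p j + (1 / 2 : ℝ) • p (j + 1) with hm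
  have hf : ∀ x, f x = f.linear x + f 0 := fun x => congrFun (AffineMap.decomp f) x
  have hy : (1 + ε) • m + (-ε) • x ∈ convexHull ℝ (Set.range p) := by
    refine h.mem_convexHull
      (μ := fun v => (1 + ε) * ((l j v + l (j + 1) v) / 2) - ε * μ v) (fun v => ?_) ?_ ?_
    · have := hε v
      have := h.nonneg j v
      have := h.nonneg (j + 1) v
      nlinarith
    · rw [Finset.sum_sub_distrib, ← Finset.mul_sum, ← Finset.mul_sum, ← Finset.sum_div,
        Finset.sum_add_distrib, h.sum_eq_one, h.sum_eq_one, h1]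
      ring
    · have hsum : ∑ v, ((1 + ε) * ((l j v + l (j + 1) v) / 2) - ε * μ v) • w v =
          ((1 + ε) / 2) • (∑ v, l j v • w v + ∑ v, l (j + 1) v • w v) - ε • ∑ v, μ v • w v := by
        simp only [Finset.smul_sum, ← Finset.sum_add_distrib, ← Finset.sum_sub_distrib]
        exact Finset.sum_congr rfl fun v _ => by module
      rw [hsum, h.combo_eq, h.combo_eq, hx, hf (p j), hf (p (j + 1)), hf x, hf (_ + _), hm]
      simp only [map_add, map_smul]
      module
  have := h.clockwise.det3_edge_nonpos j hy
  rw [det3_hat_combo _ _ _ _ _ _ (by ring), hm, det3_hat_combo _ _ _ _ _ _ (by norm_num),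
    det3_hat_self_left, det3_hat_self_right] at this
  nlinarith

theorem exists_separates (h : IsSection p w f l) (j k : Fin 6) (hkj : k ≠ j) (hkj' : k ≠ j + 1) :
    ∃ v, l k v ≠ 0 ∧ ¬ l j v ≠ 0 ∧ ¬ l (j + 1) v ≠ 0 := by
  by_contra! hcon
  refine (h.clockwise.det3_edge_neg j k hkj hkj').ne
    (h.det3_edge_eq_zero j (h.nonneg k) (h.sum_eq_one k) (h.combo_eq k) fun v hv => ?_)
  by_contra! hv'
  exact hcon v hv hv'.1 hv'.2

theorem rotate (h : IsSection p w f l) :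
    IsSection (fun i => p (i + 1)) w f fun i => l (i + 1) where
  clockwise := h.clockwise.rotate
  injective := h.injective
  inter_eq := by
    rw [h.inter_eq]
    congr 2
    exact ((Equiv.addRight (1 : Fin 6)).surjective.range_comp p).symm
  nonneg i := h.nonneg _
  sum_eq_one i := h.sum_eq_one _
  combo_eq i := h.combo_eq _

theorem permute (h : IsSection p w f l) (σ : Equiv.Perm (Fin 5)) :
    IsSection p (w ∘ σ) f fun i => l i ∘ σ where
  clockwise := h.clockwise
  injective := h.injective
  inter_eq := by rw [σ.surjective.range_comp, h.inter_eq]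
  nonneg i v := h.nonneg _ _
  sum_eq_one i := (Equiv.sum_comp σ _).trans (h.sum_eq_one i)
  combo_eq i := (Equiv.sum_comp σ fun v => l i v • w v).trans (h.combo_eq i)

/-- The vertex `w 0` of the bipyramid does not lie in the plane of the section. -/
theorem ne_apply_of_bipyramidStar (h : IsSection p w f l)
    (hl : ∀ v i, l i v ≠ 0 ↔ i ∈ bipyramidStar v) (x : Fin 2 → ℝ) : w 0 ≠ f x := by
  intro hx
  have hline : ∀ j, j ∈ bipyramidStar 0 ∨ j + 1 ∈ bipyramidStar 0 →
      det3 (hat (p j)) (hat (p (j + 1))) (hat x) = 0 := by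
    intro j hj
    refine h.det3_edge_eq_zero j (μ := Pi.single 0 1) (fun v => ?_) (by simp) ?_ fun v hv => ?_
    · by_cases hv : v = 0 <;> simp [hv]
    · simp [Pi.single_apply, hx]
    · obtain rfl : v = 0 := by
        by_contra hne
        simp [hne] at hv
      rwa [hl, hl]
  have h5 := hline 5 (by decide)
  have h0 := hline 0 (by decide)
  have h1 := hline 1 (by decide)
  have n5 := (h.clockwise.det3_edge_neg 5 1 (by decide) (by decide)).ne
  have n1 := (h.clockwise.det3_edge_neg 1 0 (by decide) (by decide)).ne
  norm_num at h5 h0 h1 n5 n1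
  rw [show (5 : Fin 6) + 1 = 0 from rfl] at h5 n5
  rw [show (1 : Fin 6) + 1 = 2 from rfl] at h1 n1
  have hx5 : det3 (hat (p 5)) (hat x) (hat (p 1)) = 0 := by
    refine (mul_eq_zero.mp ?_).resolve_right n1
    simp only [det3_hat] at *
    grind
  apply n5
  simp only [det3_hat] at *
  grind

/-- The segments cut out by the two faces of a bipyramid at a common edge of its equator lie
on lines that meet the line through this edge in the same point. -/
theorem smul_sub_smul_parallel (hf : Function.Injective f) {A B N C : Fin D → ℝ}
    (hA : ∀ x, A ≠ f x) {x y x' y' : Fin 2 → ℝ} {a n b m a' c b' d : ℝ}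
    (hx : f x = a • A + n • N) (hy : f y = b • B + m • N)
    (hx' : f x' = a' • A + c • C) (hy' : f y' = b' • B + d • C)
    (han : a + n = 1) (hbm : b + m = 1) (hac : a' + c = 1) (hbd : b' + d = 1) :
    (c * b') • (m • hat x - n • hat y) = (n * b) • (d • hat x' - c • hat y') := by
  have hdec : ∀ x, f.linear x = f x - f 0 := fun x => by
    rw [congrFun (AffineMap.decomp f) x]; simp
  set z : Fin 2 → ℝ := (c * b') • (m • x - n • y) - (n * b) • (d • x' - c • y') with hz
  set γ : ℝ := c * b' * (m * a) - n * b * (d * a') with hγ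
  have hlin : f.linear z = γ • (A - f 0) := by
    rw [hz, hγ]
    simp only [map_sub, map_smul]
    simp only [hdec, hx, hy, hx', hy']
    obtain rfl : a = 1 - n := by linarith
    obtain rfl : b = 1 - m := by linarith
    obtain rfl : a' = 1 - c := by linarith
    obtain rfl : b' = 1 - d := by linarith
    module
  have hγ0 : γ = 0 := by
    by_contra hne
    apply hA (γ⁻¹ • z)
    rw [congrFun (AffineMap.decomp f) (γ⁻¹ • z)]
    simp only [Pi.add_apply, map_smul, hlin, smul_smul, inv_mul_cancel₀ hne]
    module
  have hz0 : z = 0 := by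
    refine (f.linear_injective_iff.mpr hf) ?_
    rw [hlin, hγ0, zero_smul, map_zero]
  have hc0 := congrFun hz0 0
  have hc1 := congrFun hz0 1
  simp only [hz, Pi.sub_apply, Pi.smul_apply, smul_eq_mul, Pi.zero_apply] at hc0 hc1
  ext i
  fin_cases i
  · simp [hat]; linarith
  · simp [hat]; linarith
  · simp [hat]
    obtain rfl : a = 1 - n := by linarith
    obtain rfl : b = 1 - m := by linarith
    obtain rfl : a' = 1 - c := by linarith
    obtain rfl : b' = 1 - d := by linarith
    linear_combination hγ0

end IsSection

theorem dotProduct_cross3_eq_zero (u v : Fin 3 → ℝ) (a b : ℝ) :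
    cross3 u v ⬝ᵥ (a • u - b • v) = 0 := by
  simp [cross3, dotProduct_sub, dotProduct_smul, dotProduct_comm _ u, dotProduct_comm _ v]

theorem det3_eq_zero_of_dotProduct {u v w q : Fin 3 → ℝ} (hq : q ≠ 0) (hu : u ⬝ᵥ q = 0)
    (hv : v ⬝ᵥ q = 0) (hw : w ⬝ᵥ q = 0) : det3 u v w = 0 := by
  refine Matrix.exists_mulVec_eq_zero_iff.mp ⟨q, hq, ?_⟩
  ext i
  fin_cases i <;> simpa [Matrix.mulVec]

theorem dotProduct_eq_zero_of_smul_eq {u q r : Fin 3 → ℝ} {a b : ℝ} (ha : a ≠ 0)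
    (h : a • q = b • r) (hu : u ⬝ᵥ r = 0) : u ⬝ᵥ q = 0 := by
  have := congrArg (u ⬝ᵥ ·) h
  simpa [dotProduct_smul, hu, ha] using this

theorem IsSection.det3_cross3_eq_zero {D : ℕ} {p : Fin 6 → Fin 2 → ℝ} {w : Fin 5 → Fin D → ℝ}
    {f : (Fin 2 → ℝ) →ᵃ[ℝ] (Fin D → ℝ)} {l : Fin 6 → Fin 5 → ℝ} (h : IsSection p w f l)
    (hl : ∀ v i, l i v ≠ 0 ↔ i ∈ bipyramidStar v) :
    det3 (cross3 (hat (p 0)) (hat (p 5))) (cross3 (hat (p 1)) (hat (p 4)))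
        (cross3 (hat (p 2)) (hat (p 3))) = 0 := by
  have hz : ∀ i v, i ∉ bipyramidStar v → l i v = 0 := fun i v hi => by
    by_contra hne
    exact hi ((hl v i).mp hne)
  have hA := h.ne_apply_of_bipyramidStar hl
  have hc := h.combo_eq
  have hs := h.sum_eq_one
  simp only [Fin.sum_univ_five] at hc hs
  have c0 := hc 0
  have c1 := hc 1
  have c2 := hc 2
  have c3 := hc 3
  have c4 := hc 4
  have c5 := hc 5
  have s0 := hs 0
  have s1 := hs 1
  have s2 := hs 2
  have s3 := hs 3
  have s4 := hs 4
  have s5 := hs 5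
  rw [hz 0 1 (by decide), hz 0 3 (by decide), hz 0 4 (by decide)] at c0 s0
  rw [hz 1 1 (by decide), hz 1 2 (by decide), hz 1 4 (by decide)] at c1 s1
  rw [hz 2 1 (by decide), hz 2 2 (by decide), hz 2 3 (by decide)] at c2 s2
  rw [hz 3 0 (by decide), hz 3 2 (by decide), hz 3 3 (by decide)] at c3 s3
  rw [hz 4 0 (by decide), hz 4 2 (by decide), hz 4 4 (by decide)] at c4 s4
  rw [hz 5 0 (by decide), hz 5 3 (by decide), hz 5 4 (by decide)] at c5 s5
  simp only [zero_smul, add_zero, zero_add] at c0 c1 c2 c3 c4 c5 s0 s1 s2 s3 s4 s5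
  have hpar1 := IsSection.smul_sub_smul_parallel h.injective hA c0.symm c5.symm c1.symm c4.symm
    s0 s5 s1 s4
  have hpar2 := IsSection.smul_sub_smul_parallel h.injective hA c0.symm c5.symm c2.symm c3.symm
    s0 s5 s2 s3
  have hne : ∀ i v, i ∈ bipyramidStar v → l i v ≠ 0 := fun i v => (hl v i).mpr
  refine det3_eq_zero_of_dotProduct (q := l 5 2 • hat (p 0) - l 0 2 • hat (p 5)) ?_
    (dotProduct_cross3_eq_zero _ _ _ _)
    (dotProduct_eq_zero_of_smul_eq (mul_ne_zero (hne 1 3 (by decide)) (hne 4 1 (by decide)))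
      hpar1 (dotProduct_cross3_eq_zero _ _ _ _))
    (dotProduct_eq_zero_of_smul_eq (mul_ne_zero (hne 2 4 (by decide)) (hne 3 1 (by decide)))
      hpar2 (dotProduct_cross3_eq_zero _ _ _ _))
  intro hq
  have q0 := congrFun hq 0
  have q1 := congrFun hq 1
  have q2 := congrFun hq 2
  simp [hat] at q0 q1 q2
  have h50 : l 0 2 = l 5 2 := by linarith
  rw [h50, ← mul_sub, mul_eq_zero, or_iff_right (hne 5 2 (by decide))] at q0 q1
  refine (h.clockwise 0 1 5 (by decide) (by decide)).ne ?_
  rw [det3_hat]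
  grind

/-- A hexagonal section of a polytope with at most five vertices satisfies one of the three
concurrency conditions. -/
theorem concurrent_of_section {D : ℕ} {p : Fin 6 → Fin 2 → ℝ} (hp : Clockwise p)
    (V : Finset (Fin D → ℝ)) (f : (Fin 2 → ℝ) →ᵃ[ℝ] (Fin D → ℝ)) (hV : V.card ≤ 5)
    (hf : Function.Injective f)
    (hsec : convexHull ℝ (V : Set (Fin D → ℝ)) ∩ Set.range f =
      f '' (convexHull ℝ (Set.range p))) :
    det3 (cross3 (hat (p 0)) (hat (p 5))) (cross3 (hat (p 1)) (hat (p 4)))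
        (cross3 (hat (p 2)) (hat (p 3))) = 0 ∨
     det3 (cross3 (hat (p 1)) (hat (p 0))) (cross3 (hat (p 2)) (hat (p 5)))
        (cross3 (hat (p 3)) (hat (p 4))) = 0 ∨
     det3 (cross3 (hat (p 2)) (hat (p 1))) (cross3 (hat (p 3)) (hat (p 0)))
        (cross3 (hat (p 4)) (hat (p 5))) = 0 := by
  have hmem : ∀ i, f (p i) ∈ convexHull ℝ (V : Set (Fin D → ℝ)) := fun i =>
    (hsec.symm ▸ Set.mem_image_of_mem f (subset_convexHull ℝ _ ⟨i, rfl⟩) :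
      f (p i) ∈ convexHull ℝ (V : Set (Fin D → ℝ)) ∩ Set.range f).1
  have hne : V.Nonempty := by
    rw [← Finset.coe_nonempty, ← convexHull_nonempty_iff (𝕜 := ℝ)]
    exact ⟨_, hmem 0⟩
  obtain ⟨w, hw⟩ := exists_range_eq_coe V hne hV
  rw [← hw] at hmem hsec
  choose l h0 h1 hl using fun i => (mem_convexHull_range_iff _ _).mp (hmem i)
  have h : IsSection p w f l := ⟨hp, hf, hsec, h0, h1, hl⟩
  obtain ⟨r, σ, hσ⟩ := exists_bipyramidStar_of_separates (fun i v => l i v ≠ 0) h.exists_separates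
  have h' := h.permute σ
  fin_cases r
  · exact Or.inl (h'.det3_cross3_eq_zero fun v i => by simpa using hσ v i)
  · exact Or.inr (Or.inl (h'.rotate.det3_cross3_eq_zero fun v i => hσ v i))
  · refine Or.inr (Or.inr (h'.rotate.rotate.det3_cross3_eq_zero fun v i => ?_))
    rw [add_assoc]
    exact hσ v i

theorem det3_hat_smul_hat (a b c e : Fin 2 → ℝ) :
    det3 (hat b) (hat c) (hat e) • hat a - det3 (hat a) (hat c) (hat e) • hat b
      + det3 (hat a) (hat b) (hat e) • hat c - det3 (hat a) (hat b) (hat c) • hat e = 0 := by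
  simp only [det3_hat]
  ext i
  fin_cases i <;> simp [hat] <;> ring

/-- If the lines through `p 0, p 5`, through `p 1, p 4` and through `p 2, p 3` are concurrent, then
the common point is a difference of positive multiples of the two points on each line. -/
theorem Clockwise.exists_pos_smul_sub_eq {p : Fin 6 → Fin 2 → ℝ} (hp : Clockwise p)
    (h : det3 (cross3 (hat (p 0)) (hat (p 5))) (cross3 (hat (p 1)) (hat (p 4)))
        (cross3 (hat (p 2)) (hat (p 3))) = 0) :
    ∃ t : Fin 6 → ℝ, (∀ i, 0 < t i) ∧
      t 0 • hat (p 0) - t 5 • hat (p 5) = t 1 • hat (p 1) - t 4 • hat (p 4) ∧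
      t 0 • hat (p 0) - t 5 • hat (p 5) = t 2 • hat (p 2) - t 3 • hat (p 3) := by
  set d : Fin 6 → Fin 6 → Fin 6 → ℝ := fun i j k => det3 (hat (p i)) (hat (p j)) (hat (p k))
    with hd
  have hneg : ∀ i j k, i < j → j < k → d i j k < 0 := hp
  have h145 := hneg 1 4 5 (by decide) (by decide)
  have h014 := hneg 0 1 4 (by decide) (by decide)
  have h045 := hneg 0 4 5 (by decide) (by decide)
  have h015 := hneg 0 1 5 (by decide) (by decide)
  have h134 := hneg 1 3 4 (by decide) (by decide)
  have h234 := hneg 2 3 4 (by decide) (by decide)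
  have h124 := hneg 1 2 4 (by decide) (by decide)
  have h123 := hneg 1 2 3 (by decide) (by decide)
  have hcon : d 0 4 5 * d 1 2 3 = d 0 1 5 * d 2 3 4 := by
    rw [← sub_eq_zero, ← neg_eq_zero, ← h]
    simp only [hd, det3_hat]
    simp [det3, hat, cross3, crossProduct, Matrix.det_fin_three]
    ring
  have h0145 : (-d 1 4 5) • hat (p 0) - (-d 0 1 4) • hat (p 5) =
      (-d 0 4 5) • hat (p 1) - (-d 0 1 5) • hat (p 4) := by
    rw [← sub_eq_zero, ← neg_eq_zero, ← det3_hat_smul_hat (p 0) (p 1) (p 4) (p 5)]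
    module
  refine ⟨![-d 1 4 5, -d 0 4 5, -d 0 4 5 * (d 1 3 4 / d 2 3 4), -d 0 1 5 * (d 1 2 4 / d 1 2 3),
    -d 0 1 5, -d 0 1 4], ?_, h0145, h0145.trans ?_⟩
  · have h2 := mul_pos (neg_pos.mpr h045) (div_pos_of_neg_of_neg h134 h234)
    have h3 := mul_pos (neg_pos.mpr h015) (div_pos_of_neg_of_neg h124 h123)
    intro i
    fin_cases i
    exacts [neg_pos.mpr h145, neg_pos.mpr h045, h2, h3, neg_pos.mpr h015, neg_pos.mpr h014]
  · ext c
    have h1234 := congrFun (det3_hat_smul_hat (p 1) (p 2) (p 3) (p 4)) c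
    change _ = (-d 0 4 5 * (d 1 3 4 / d 2 3 4)) * hat (p 2) c
      - (-d 0 1 5 * (d 1 2 4 / d 1 2 3)) * hat (p 3) c
    change d 2 3 4 * hat (p 1) c - d 1 3 4 * hat (p 2) c + d 1 2 4 * hat (p 3) c
      - d 1 2 3 * hat (p 4) c = 0 at h1234
    simp only [Pi.sub_apply, Pi.smul_apply, smul_eq_mul]
    field_simp [h234.ne, h123.ne]
    linear_combination (-d 0 4 5 * d 1 2 3) * h1234
      - (d 1 2 3 * hat (p 4) c - d 1 2 4 * hat (p 3) c) * hcon

/-- If the common point of the lines through `p 0, p 5`, through `p 1, p 4` and through `p 2, p 3`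
is a difference of positive multiples of the two points on each line, then the convex hull of the
`p i` is a plane section of a triangular bipyramid. -/
theorem exists_section_of_pos_smul_sub_eq (p : Fin 6 → Fin 2 → ℝ) (t : Fin 6 → ℝ)
    (ht : ∀ i, 0 < t i)
    (h1 : t 0 • hat (p 0) - t 5 • hat (p 5) = t 1 • hat (p 1) - t 4 • hat (p 4))
    (h2 : t 0 • hat (p 0) - t 5 • hat (p 5) = t 2 • hat (p 2) - t 3 • hat (p 3)) :
    ∃ (V : Finset (Fin 3 → ℝ)) (f : (Fin 2 → ℝ) →ᵃ[ℝ] (Fin 3 → ℝ)),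
      V.card ≤ 5 ∧ Function.Injective f ∧
      convexHull ℝ (V : Set (Fin 3 → ℝ)) ∩ Set.range f =
        f '' (convexHull ℝ (Set.range p)) := by
  classical
  have e10 := congrFun h1 0
  have e11 := congrFun h1 1
  have e12 := congrFun h1 2
  have e20 := congrFun h2 0
  have e21 := congrFun h2 1
  have e22 := congrFun h2 2
  simp [hat] at e10 e11 e12 e20 e21 e22
  have t0 := ht 0
  have t1 := ht 1
  have t2 := ht 2
  have t3 := ht 3
  have t4 := ht 4
  have t5 := ht 5
  obtain ⟨h, hlo, hhi⟩ : ∃ h, max 0 (t 0 - t 5) < h ∧ h < min (t 0) (min (t 1) (t 2)) := by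
    refine exists_between ?_
    simp only [max_lt_iff, lt_min_iff]
    refine ⟨⟨t0, ?_⟩, ⟨t1, ?_⟩, ⟨t2, ?_⟩⟩ <;> linarith
  simp only [max_lt_iff, lt_min_iff] at hlo hhi
  obtain ⟨hA, hB⟩ := hlo
  obtain ⟨hN, hC, hS⟩ := hhi
  replace hB : 0 < h - (t 0 - t 5) := by linarith
  replace hN : 0 < t 0 - h := by linarith
  replace hC : 0 < t 1 - h := by linarith
  replace hS : 0 < t 2 - h := by linarith
  set A : Fin 3 → ℝ := ![0, 0, 1 / h] with hAdef
  set B : Fin 3 → ℝ := ![(t 5 * p 5 0 - t 0 * p 0 0) / (h - (t 0 - t 5)),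
    (t 5 * p 5 1 - t 0 * p 0 1) / (h - (t 0 - t 5)), 1 / (h - (t 0 - t 5))] with hBdef
  set N : Fin 3 → ℝ := ![t 0 * p 0 0 / (t 0 - h), t 0 * p 0 1 / (t 0 - h), -1 / (t 0 - h)]
    with hNdef
  set C : Fin 3 → ℝ := ![t 1 * p 1 0 / (t 1 - h), t 1 * p 1 1 / (t 1 - h), -1 / (t 1 - h)]
    with hCdef
  set S : Fin 3 → ℝ := ![t 2 * p 2 0 / (t 2 - h), t 2 * p 2 1 / (t 2 - h), -1 / (t 2 - h)]
    with hSdef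
  set w : Fin 5 → Fin 3 → ℝ := ![A, B, N, C, S] with hw
  let f : (Fin 2 → ℝ) →ₗ[ℝ] (Fin 3 → ℝ) :=
    { toFun := fun x => ![x 0, x 1, 0]
      map_add' := fun x y => by ext i; fin_cases i <;> simp
      map_smul' := fun c x => by ext i; fin_cases i <;> simp }
  have hf : ∀ x, f.toAffineMap x = ![x 0, x 1, 0] := fun x => rfl
  refine ⟨Finset.univ.image w, f.toAffineMap, ?_, ?_, ?_⟩
  · exact Finset.card_image_le
  · intro x y hxy
    rw [hf, hf] at hxy
    have := congrFun hxy 0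
    have := congrFun hxy 1
    ext i
    fin_cases i <;> simpa
  · rw [Finset.coe_image, Finset.coe_univ, Set.image_univ]
    refine Set.Subset.antisymm ?_ (Set.subset_inter ?_ (Set.image_subset_range _ _))
    · rintro _ ⟨hx, x, rfl⟩
      refine Set.mem_image_of_mem _ ?_
      obtain ⟨l, l0, l1, hl⟩ := (mem_convexHull_range_iff _ _).mp hx
      obtain ⟨μ, hμ⟩ : ∃ μ : Fin 5 → ℝ, l = ![h * μ 0, (h - (t 0 - t 5)) * μ 1,
          (t 0 - h) * μ 2, (t 1 - h) * μ 3, (t 2 - h) * μ 4] := by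
        refine ⟨![l 0 / h, l 1 / (h - (t 0 - t 5)), l 2 / (t 0 - h), l 3 / (t 1 - h),
          l 4 / (t 2 - h)], ?_⟩
        ext i
        fin_cases i <;> simp <;> field_simp
      have m0 : 0 ≤ μ 0 := (mul_nonneg_iff_of_pos_left hA).mp (by simpa [hμ] using l0 0)
      have m1 : 0 ≤ μ 1 := (mul_nonneg_iff_of_pos_left hB).mp (by simpa [hμ] using l0 1)
      have m2 : 0 ≤ μ 2 := (mul_nonneg_iff_of_pos_left hN).mp (by simpa [hμ] using l0 2)
      have m3 : 0 ≤ μ 3 := (mul_nonneg_iff_of_pos_left hC).mp (by simpa [hμ] using l0 3)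
      have m4 : 0 ≤ μ 4 := (mul_nonneg_iff_of_pos_left hS).mp (by simpa [hμ] using l0 4)
      have hx0 := congrFun hl 0
      have hx1 := congrFun hl 1
      have hx2 := congrFun hl 2
      simp only [Fin.sum_univ_five] at l1
      simp only [hf, Fin.sum_univ_five, hw, hAdef, hBdef, hNdef, hCdef, hSdef, hμ, Pi.add_apply,
        Pi.smul_apply, smul_eq_mul, Matrix.cons_val] at l1 hx0 hx1 hx2
      have hx2' : μ 0 + μ 1 = μ 2 + μ 3 + μ 4 := by
        field_simp at hx2
        linarith
      have hM : 0 < μ 0 + μ 1 := by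
        by_contra hM
        obtain ⟨z0, z1, z2, z3, z4⟩ : μ 0 = 0 ∧ μ 1 = 0 ∧ μ 2 = 0 ∧ μ 3 = 0 ∧ μ 4 = 0 := by
          refine ⟨?_, ?_, ?_, ?_, ?_⟩ <;> linarith
        simp [z0, z1, z2, z3, z4] at l1
      rw [mem_convexHull_range_iff]
      refine ⟨![μ 0 * μ 2 * t 0 / (μ 0 + μ 1), μ 0 * μ 3 * t 1 / (μ 0 + μ 1),
        μ 0 * μ 4 * t 2 / (μ 0 + μ 1), μ 1 * μ 4 * t 3 / (μ 0 + μ 1),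
        μ 1 * μ 3 * t 4 / (μ 0 + μ 1), μ 1 * μ 2 * t 5 / (μ 0 + μ 1)], ?_, ?_, ?_⟩
      · intro i
        fin_cases i <;> dsimp <;> positivity
      · simp only [Fin.sum_univ_six, Matrix.cons_val]
        field_simp
        linear_combination (μ 0 + μ 1) * l1
          + ((t 0 - t 5) * μ 1 - h * (μ 0 + μ 1)) * hx2' + μ 1 * μ 3 * e12 + μ 1 * μ 4 * e22
      · ext c
        fin_cases c
        · simp [Fin.sum_univ_six]
          field_simp at hx0 ⊢
          linear_combination (μ 0 + μ 1) * hx0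
            + (t 0 * p 0 0 - t 5 * p 5 0) * μ 1 * hx2' + μ 1 * μ 3 * e10 + μ 1 * μ 4 * e20
        · simp [Fin.sum_univ_six]
          field_simp at hx1 ⊢
          linear_combination (μ 0 + μ 1) * hx1
            + (t 0 * p 0 1 - t 5 * p 5 1) * μ 1 * hx2' + μ 1 * μ 3 * e11 + μ 1 * μ 4 * e21
    · rw [AffineMap.image_convexHull, ← Set.range_comp]
      refine convexHull_min ?_ (convex_convexHull ℝ _)
      have hseg : ∀ i u v, ∀ r a b : ℝ, 0 < r → 0 < a → 0 < b → a + b = r →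
          r • f (p i) = a • w u + b • w v → f (p i) ∈ convexHull ℝ (Set.range w) := by
        intro i u v r a b hr ha hb hab heq
        have := convex_convexHull ℝ (Set.range w) (subset_convexHull ℝ _ ⟨u, rfl⟩)
          (subset_convexHull ℝ _ ⟨v, rfl⟩) (div_pos ha hr).le (div_pos hb hr).le
          (by rw [← add_div, hab, div_self hr.ne'])
        convert this using 1
        rw [← inv_smul_smul₀ hr.ne' (f (p i)), heq, smul_add, smul_smul, smul_smul]
        simp only [div_eq_inv_mul]
      have hfp : ∀ i, f (p i) = ![p i 0, p i 1, 0] := fun i => rfl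
      rintro _ ⟨i, rfl⟩
      fin_cases i
      · refine hseg 0 0 2 (t 0) (h) (t 0 - h) t0 hA hN (by linarith) ?_
        ext c
        fin_cases c <;> simp [hfp, hw, hAdef, hBdef, hNdef, hCdef, hSdef] <;> field_simp <;>
          linarith
      · refine hseg 1 0 3 (t 1) (h) (t 1 - h) t1 hA hC (by linarith) ?_
        ext c
        fin_cases c <;> simp [hfp, hw, hAdef, hBdef, hNdef, hCdef, hSdef] <;> field_simp <;>
          linarith
      · refine hseg 2 0 4 (t 2) (h) (t 2 - h) t2 hA hS (by linarith) ?_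
        ext c
        fin_cases c <;> simp [hfp, hw, hAdef, hBdef, hNdef, hCdef, hSdef] <;> field_simp <;>
          linarith
      · refine hseg 3 1 4 (t 3) (h - (t 0 - t 5)) (t 2 - h) t3 hB hS (by linarith) ?_
        ext c
        fin_cases c <;> simp [hfp, hw, hAdef, hBdef, hNdef, hCdef, hSdef] <;> field_simp <;>
          linarith
      · refine hseg 4 1 3 (t 4) (h - (t 0 - t 5)) (t 1 - h) t4 hB hC (by linarith) ?_
        ext c
        fin_cases c <;> simp [hfp, hw, hAdef, hBdef, hNdef, hCdef, hSdef] <;> field_simp <;>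
          linarith
      · refine hseg 5 1 2 (t 5) (h - (t 0 - t 5)) (t 0 - h) t5 hB hN (by linarith) ?_
        ext c
        fin_cases c <;> simp [hfp, hw, hAdef, hBdef, hNdef, hCdef, hSdef] <;> field_simp <;>
          linarith

/-- A hexagon is a section of a polytope with at most 5 vertices (in some ℝ^D, D ≥ 2)
if and only if, for some cyclic labeling of its vertices, the three main diagonals'
lines `p₀p₅`, `p₁p₄`, `p₂p₃` are concurrent in the projective plane. -/
theorem hexagon_ic_five_iff_concurrent
    (p : Fin 6 → Fin 2 → ℝ)
    (hconv : ∀ i j k : Fin 6, i < j → j < k →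
      det3 (hat (p i)) (hat (p j)) (hat (p k)) < 0) :
    (∃ (D : ℕ), 2 ≤ D ∧
      ∃ (V : Finset (Fin D → ℝ)) (f : (Fin 2 → ℝ) →ᵃ[ℝ] (Fin D → ℝ)),
        V.card ≤ 5 ∧ Function.Injective f ∧
        convexHull ℝ (V : Set (Fin D → ℝ)) ∩ Set.range f =
          f '' (convexHull ℝ (Set.range p))) ↔
    (det3 (cross3 (hat (p 0)) (hat (p 5))) (cross3 (hat (p 1)) (hat (p 4)))
        (cross3 (hat (p 2)) (hat (p 3))) = 0 ∨
     det3 (cross3 (hat (p 1)) (hat (p 0))) (cross3 (hat (p 2)) (hat (p 5)))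
        (cross3 (hat (p 3)) (hat (p 4))) = 0 ∨
     det3 (cross3 (hat (p 2)) (hat (p 1))) (cross3 (hat (p 3)) (hat (p 0)))
        (cross3 (hat (p 4)) (hat (p 5))) = 0) := by
  have hp : Clockwise p := hconv
  constructor
  · rintro ⟨D, -, V, f, hV, hf, hsec⟩
    exact concurrent_of_section hp V f hV hf hsec
  · have hrange : ∀ q : Fin 6 → Fin 2 → ℝ, Set.range (fun i => q (i + 1)) = Set.range q :=
      fun q => (Equiv.addRight (1 : Fin 6)).surjective.range_comp q
    refine fun h => ⟨3, by norm_num, ?_⟩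
    rcases h with h | h | h
    · obtain ⟨t, ht, h1, h2⟩ := hp.exists_pos_smul_sub_eq h
      exact exists_section_of_pos_smul_sub_eq p t ht h1 h2
    · obtain ⟨t, ht, h1, h2⟩ := hp.rotate.exists_pos_smul_sub_eq h
      rw [← hrange p]
      exact exists_section_of_pos_smul_sub_eq _ t ht h1 h2
    · obtain ⟨t, ht, h1, h2⟩ := hp.rotate.rotate.exists_pos_smul_sub_eq h
      rw [← hrange p, ← hrange fun i => p (i + 1)]
      exact exists_section_of_pos_smul_sub_eq _ t ht h1 h2
end

section
/- For any 7 points a_0, …, a_6 ∈ ℝ² (indices modulo 7, no convexity assumed), the identity ∑_{i ∈ ℤ/7ℤ} E_i F_i = ∑_{i ∈ ℤ/7ℤ} C_i D_i holds, where C_i = [−1,−2,0]_i, D_i = [2,1,−3]_i, E_i = [2,1,0]_i, F_i = [−1,−2,3]_i. -/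
open Matrix

/-- The bracket `[x, y, z]_i` of a configuration of 7 points, indices mod 7. -/
noncomputable def br (a : Fin 7 → Fin 2 → ℝ) (i x y z : Fin 7) : ℝ :=
  det3 (hat (a (i + x))) (hat (a (i + y))) (hat (a (i + z)))

theorem det3_hat_s10 (p q r : Fin 2 → ℝ) :
    det3 (hat p) (hat q) (hat r) =
      (q 0 - p 0) * (r 1 - p 1) - (q 1 - p 1) * (r 0 - p 0) := by
  simp [det3, hat, Matrix.det_fin_three]
  ring

/-- The identity `∑ᵢ EᵢFᵢ = ∑ᵢ CᵢDᵢ` for any 7 points in the plane, where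
`Cᵢ = [−1,−2,0]ᵢ`, `Dᵢ = [2,1,−3]ᵢ`, `Eᵢ = [2,1,0]ᵢ`, `Fᵢ = [−1,−2,3]ᵢ`. -/
theorem heptagon_bracket_identity_EF_CD (a : Fin 7 → Fin 2 → ℝ) :
    ∑ i : Fin 7, br a i 2 1 0 * br a i (-1) (-2) 3 =
      ∑ i : Fin 7, br a i (-1) (-2) 0 * br a i 2 1 (-3) := by
  have h1 : (-1 : Fin 7) = 6 := rfl
  have h2 : (-2 : Fin 7) = 5 := rfl
  have h3 : (-3 : Fin 7) = 4 := rfl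
  simp only [br, det3_hat_s10, Fin.sum_univ_seven, h1, h2, h3, Fin.isValue, Fin.reduceAdd]
  ring
end
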